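/- (Bourdaud) For f ∈ bmo(ℝⁿ), lim_{t→0⁺} ω(f,t) = 0 if and only if there exist bounded uniformly continuous functions g_j on ℝⁿ with ‖f − g_j‖_{bmo(ℝⁿ)} → 0. -/

import Mathlib

open MeasureTheory Metric Filter Topology

noncomputable section

/-- A closed axis-parallel cube in ℝⁿ: a closed ball in the sup norm with
positive radius (`half` = half the sidelength). -/
structure Cube (n : ℕ) where
  center : Fin n → ℝ
  half : ℝ
  half_pos : 0 < half

namespace Cube

variable {n : ℕ}

/-- The underlying set of a cube. -/
def toSet (Q : Cube n) : Set (Fin n → ℝ) := Metric.closedBall Q.center Q.half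

/-- The sidelength ℓ(Q). -/
def side (Q : Cube n) : ℝ := 2 * Q.half

/-- The mean f_Q of f over Q. -/
def avg (Q : Cube n) (f : (Fin n → ℝ) → ℝ) : ℝ := ⨍ x in Q.toSet, f x

/-- Mean oscillation of f over Q. -/
def osc (Q : Cube n) (f : (Fin n → ℝ) → ℝ) : ℝ := ⨍ x in Q.toSet, |f x - Q.avg f|

/-- The mean |f|_Q of |f| over Q. -/
def avgAbs (Q : Cube n) (f : (Fin n → ℝ) → ℝ) : ℝ := ⨍ x in Q.toSet, |f x|

/-- Distance from the cube to the origin. -/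
def distToOrigin (Q : Cube n) : ℝ := Metric.infDist (0 : Fin n → ℝ) Q.toSet

/-- The cube 2Q, concentric with Q and of twice the sidelength. -/
def double (Q : Cube n) : Cube n := ⟨Q.center, 2 * Q.half, mul_pos two_pos Q.half_pos⟩

end Cube

variable {n : ℕ}

/-- The modulus of mean oscillation ω_U(f,t): the supremum of the mean oscillation
of f over cubes Q ⊆ U of sidelength < t. -/
def omegaOn (U : Set (Fin n → ℝ)) (f : (Fin n → ℝ) → ℝ) (t : ℝ) : ℝ :=
  sSup {r | ∃ Q : Cube n, Q.toSet ⊆ U ∧ Q.side < t ∧ r = Q.osc f}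

/-- sup{ |f|_Q : Q ⊆ U, ℓ(Q) ≥ lam }. -/
def bigAvgSup (U : Set (Fin n → ℝ)) (lam : ℝ) (f : (Fin n → ℝ) → ℝ) : ℝ :=
  sSup {r | ∃ Q : Cube n, Q.toSet ⊆ U ∧ lam ≤ Q.side ∧ r = Q.avgAbs f}

/-- The nonhomogeneous norm ‖f‖_{bmo_lam(U)}. -/
def bmoNorm (U : Set (Fin n → ℝ)) (lam : ℝ) (f : (Fin n → ℝ) → ℝ) : ℝ :=
  omegaOn U f lam + bigAvgSup U lam f

/-- Membership in bmo_lam(U): integrable on every cube in U and finite norm. -/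
def MemBmo (U : Set (Fin n → ℝ)) (lam : ℝ) (f : (Fin n → ℝ) → ℝ) : Prop :=
  (∀ Q : Cube n, Q.toSet ⊆ U → IntegrableOn f Q.toSet) ∧
  BddAbove {r | ∃ Q : Cube n, Q.toSet ⊆ U ∧ Q.side < lam ∧ r = Q.osc f} ∧
  BddAbove {r | ∃ Q : Cube n, Q.toSet ⊆ U ∧ lam ≤ Q.side ∧ r = Q.avgAbs f}

/-- Sarason's vanishing mean oscillation condition: ω_U(f,t) → 0 as t → 0⁺. -/
def VanishSmallOsc (U : Set (Fin n → ℝ)) (f : (Fin n → ℝ) → ℝ) : Prop :=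
  Tendsto (fun t => omegaOn U f t) (nhdsWithin 0 (Set.Ioi 0)) (nhds 0)

/-- f is bounded on U. -/
def BoundedOn (U : Set (Fin n → ℝ)) (f : (Fin n → ℝ) → ℝ) : Prop :=
  ∃ M : ℝ, ∀ x ∈ U, |f x| ≤ M

/-- f is Lipschitz on U. -/
def LipschitzOn (U : Set (Fin n → ℝ)) (f : (Fin n → ℝ) → ℝ) : Prop :=
  ∃ K : NNReal, LipschitzOnWith K f U

/-- dist(supp f, ∂U) > 0. -/
def SuppAway (U : Set (Fin n → ℝ)) (f : (Fin n → ℝ) → ℝ) : Prop :=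
  ∃ d > 0, ∀ x ∈ Function.support f, ∀ y ∈ frontier U, d ≤ dist x y

/-- The nonhomogeneous Lipschitz norm ‖f‖_{Lip_b(U)} = ‖f‖_∞ + Lipschitz seminorm. -/
def lipbNorm (U : Set (Fin n → ℝ)) (f : (Fin n → ℝ) → ℝ) : ℝ :=
  sSup {r | ∃ x ∈ U, r = |f x|} +
  sSup {r | ∃ x ∈ U, ∃ y ∈ U, x ≠ y ∧ r = |f x - f y| / dist x y}

/-- U is a domain: a nonempty open connected subset of ℝⁿ. -/
def IsRealDomain (U : Set (Fin n → ℝ)) : Prop := IsOpen U ∧ IsConnected U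

/-- U is an (ε,δ)-domain. -/
def IsEpsDeltaDomain (U : Set (Fin n → ℝ)) (ε δ : ℝ) : Prop :=
  ∀ x ∈ U, ∀ y ∈ U, dist x y < δ →
    ∃ γ : ℝ → (Fin n → ℝ), ContinuousOn γ (Set.Icc 0 1) ∧ γ 0 = x ∧ γ 1 = y ∧
      (∀ t ∈ Set.Icc (0:ℝ) 1, γ t ∈ U) ∧
      eVariationOn γ (Set.Icc 0 1) ≤ ENNReal.ofReal (ε⁻¹ * dist x y) ∧
      ∀ t ∈ Set.Icc (0:ℝ) 1,
        ε * (dist (γ t) x * dist (γ t) y) / dist x y ≤ Metric.infDist (γ t) (frontier U)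

/-- The natural scale λ_{ε,δ} for an (ε,δ)-domain. -/
def lamED (n : ℕ) (ε δ : ℝ) : ℝ := ε ^ 2 * δ / (320 * n * (1 + Real.sqrt n * ε))

/-- d_Ω(x) = dist(x,∂Ω). -/
def distBd (U : Set (Fin n → ℝ)) (x : Fin n → ℝ) : ℝ := Metric.infDist x (frontier U)

/-- Ω̊_t = {x ∈ Ω : d_Ω(x) ≥ t}. -/
def innerPart (U : Set (Fin n → ℝ)) (t : ℝ) : Set (Fin n → ℝ) :=
  {x ∈ U | t ≤ distBd U x}

/-- f vanishes at infinity in the bmo_lam(U) sense. -/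
def VanishAtInfinity (U : Set (Fin n → ℝ)) (lam : ℝ) (f : (Fin n → ℝ) → ℝ) : Prop :=
  Tendsto (fun R => bmoNorm (U \ Metric.closedBall 0 R) lam f) atTop (nhds 0)

/-- f vanishes at the boundary in the bmo_lam(U) sense. -/
def VanishAtBoundary (U : Set (Fin n → ℝ)) (lam : ℝ) (f : (Fin n → ℝ) → ℝ) : Prop :=
  Tendsto (fun t => bmoNorm (U \ innerPart U t) lam f) (nhdsWithin 0 (Set.Ioi 0)) (nhds 0)

/-- f is in the bmo_lam(U)-closure of the continuous functions with compact support in U. -/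
def InCmoClosure (U : Set (Fin n → ℝ)) (lam : ℝ) (f : (Fin n → ℝ) → ℝ) : Prop :=
  ∃ g : ℕ → (Fin n → ℝ) → ℝ,
    (∀ j, Continuous (g j) ∧ HasCompactSupport (g j) ∧ tsupport (g j) ⊆ U) ∧
    Tendsto (fun j => bmoNorm U lam (f - g j)) atTop (nhds 0)

/-- The homogeneous BMO(ℝⁿ) seminorm: sup of mean oscillation over all cubes. -/
def bmoHNorm (f : (Fin n → ℝ) → ℝ) : ℝ := sSup {r | ∃ Q : Cube n, r = Q.osc f}

namespace Cube

lemma measureReal_toSet (Q : Cube n) : volume.real Q.toSet = (2 * Q.half) ^ n := by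
  have h := Q.half_pos
  rw [toSet, measureReal_def, Real.volume_pi_closedBall _ h.le, Fintype.card_fin,
    ENNReal.toReal_ofReal (by positivity)]

lemma measureReal_toSet_pos (Q : Cube n) : 0 < volume.real Q.toSet := by
  have h := Q.half_pos
  rw [measureReal_toSet]
  positivity

lemma isCompact_toSet (Q : Cube n) : IsCompact Q.toSet := isCompact_closedBall _ _

lemma measurableSet_toSet (Q : Cube n) : MeasurableSet Q.toSet := measurableSet_closedBall

lemma integrableOn_const (Q : Cube n) (c : ℝ) : IntegrableOn (fun _ => c) Q.toSet :=
  continuous_const.continuousOn.integrableOn_compact Q.isCompact_toSet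

lemma avgAbs_eq (Q : Cube n) (f : (Fin n → ℝ) → ℝ) :
    Q.avgAbs f = (volume.real Q.toSet)⁻¹ * ∫ x in Q.toSet, |f x| := by
  rw [avgAbs, setAverage_eq, smul_eq_mul]

lemma osc_eq_avgAbs (Q : Cube n) (f : (Fin n → ℝ) → ℝ) :
    Q.osc f = Q.avgAbs (fun x => f x - Q.avg f) := rfl

lemma avgAbs_nonneg (Q : Cube n) (f : (Fin n → ℝ) → ℝ) : 0 ≤ Q.avgAbs f := by
  rw [avgAbs_eq]
  positivity

lemma osc_nonneg (Q : Cube n) (f : (Fin n → ℝ) → ℝ) : 0 ≤ Q.osc f :=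
  Q.avgAbs_nonneg _

lemma integral_abs_eq (Q : Cube n) (f : (Fin n → ℝ) → ℝ) :
    ∫ x in Q.toSet, |f x| = volume.real Q.toSet * Q.avgAbs f := by
  rw [avgAbs_eq, mul_inv_cancel_left₀ Q.measureReal_toSet_pos.ne']

lemma avgAbs_le_of_le_add (Q : Cube n) {f g h : (Fin n → ℝ) → ℝ}
    (hf : IntegrableOn f Q.toSet) (hg : IntegrableOn g Q.toSet) (hh : IntegrableOn h Q.toSet)
    (hle : ∀ x ∈ Q.toSet, |f x| ≤ |g x| + |h x|) : Q.avgAbs f ≤ Q.avgAbs g + Q.avgAbs h := by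
  rw [avgAbs_eq, avgAbs_eq, avgAbs_eq, ← mul_add, ← integral_add hg.abs hh.abs]
  refine mul_le_mul_of_nonneg_left ?_ (inv_nonneg.2 Q.measureReal_toSet_pos.le)
  exact setIntegral_mono_on hf.abs (hg.abs.add hh.abs) Q.measurableSet_toSet hle

lemma avgAbs_const (Q : Cube n) (c : ℝ) : Q.avgAbs (fun _ => c) = |c| := by
  rw [avgAbs_eq, setIntegral_const, smul_eq_mul,
    inv_mul_cancel_left₀ Q.measureReal_toSet_pos.ne']

lemma avgAbs_le_of_forall_le (Q : Cube n) {f : (Fin n → ℝ) → ℝ}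
    (hf : IntegrableOn f Q.toSet) {M : ℝ} (hM : 0 ≤ M) (h : ∀ x ∈ Q.toSet, |f x| ≤ M) :
    Q.avgAbs f ≤ M := by
  have := Q.avgAbs_le_of_le_add hf (Q.integrableOn_const M) (Q.integrableOn_const 0)
    (fun x hx => by simpa [abs_of_nonneg hM] using h x hx)
  simpa [avgAbs_const, abs_of_nonneg hM] using this

lemma avg_sub (Q : Cube n) {f g : (Fin n → ℝ) → ℝ}
    (hf : IntegrableOn f Q.toSet) (hg : IntegrableOn g Q.toSet) :
    Q.avg (f - g) = Q.avg f - Q.avg g := by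
  simp only [avg, setAverage_eq, smul_eq_mul, Pi.sub_apply]
  rw [integral_sub hf hg, mul_sub]

lemma abs_avg_le (Q : Cube n) (f : (Fin n → ℝ) → ℝ) : |Q.avg f| ≤ Q.avgAbs f := by
  rw [avgAbs_eq, avg, setAverage_eq, smul_eq_mul, abs_mul,
    abs_of_pos (inv_pos.2 Q.measureReal_toSet_pos)]
  have hpos := Q.measureReal_toSet_pos
  gcongr
  exact abs_integral_le_integral_abs

lemma avg_const (Q : Cube n) (c : ℝ) : Q.avg (fun _ => c) = c := by
  rw [avg, setAverage_eq, setIntegral_const, smul_eq_mul, smul_eq_mul,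
    inv_mul_cancel_left₀ Q.measureReal_toSet_pos.ne']

/-- The mean is, up to a factor `2`, the best constant for the mean oscillation. -/
lemma osc_le_two_mul_avgAbs_sub (Q : Cube n) {f : (Fin n → ℝ) → ℝ}
    (hf : IntegrableOn f Q.toSet) (c : ℝ) : Q.osc f ≤ 2 * Q.avgAbs (fun x => f x - c) := by
  have hc := Q.integrableOn_const c
  have h1 : Q.avg (fun x => f x - c) = Q.avg f - c := by
    have := Q.avg_sub hf hc
    rwa [avg_const] at this
  have h2 := Q.abs_avg_le (fun x => f x - c)
  rw [h1] at h2
  have h3 : Q.osc f ≤ Q.avgAbs (fun x => f x - c) + Q.avgAbs (fun _ => Q.avg f - c) := by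
    rw [osc_eq_avgAbs]
    refine Q.avgAbs_le_of_le_add (hf.sub (Q.integrableOn_const _)) (hf.sub hc)
      (Q.integrableOn_const _) fun x _ => ?_
    have := abs_sub (f x - c) (Q.avg f - c)
    rwa [sub_sub_sub_cancel_right] at this
  rw [avgAbs_const] at h3
  linarith

lemma osc_le_two_mul_avgAbs (Q : Cube n) {f : (Fin n → ℝ) → ℝ}
    (hf : IntegrableOn f Q.toSet) : Q.osc f ≤ 2 * Q.avgAbs f := by
  simpa using Q.osc_le_two_mul_avgAbs_sub hf 0

lemma osc_le_of_forall_abs_sub_le (Q : Cube n) {f : (Fin n → ℝ) → ℝ}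
    (hf : IntegrableOn f Q.toSet) {c M : ℝ} (hM : 0 ≤ M)
    (h : ∀ x ∈ Q.toSet, |f x - c| ≤ M) : Q.osc f ≤ 2 * M :=
  (Q.osc_le_two_mul_avgAbs_sub hf c).trans <| by
    have := Q.avgAbs_le_of_forall_le (hf.sub (Q.integrableOn_const c)) hM h
    simp only [Pi.sub_def] at this
    linarith

lemma osc_sub_le (Q : Cube n) {f g : (Fin n → ℝ) → ℝ}
    (hf : IntegrableOn f Q.toSet) (hg : IntegrableOn g Q.toSet) :
    Q.osc (f - g) ≤ Q.osc f + Q.osc g := by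
  simp only [osc_eq_avgAbs, Q.avg_sub hf hg]
  refine Q.avgAbs_le_of_le_add ((hf.sub hg).sub (Q.integrableOn_const _))
    (hf.sub (Q.integrableOn_const _)) (hg.sub (Q.integrableOn_const _)) fun x _ => ?_
  have := abs_sub (f x - Q.avg f) (g x - Q.avg g)
  rwa [sub_sub_sub_comm] at this

end Cube

/-- A uniform bound for the integrals of `|h|` over cubes of half-side `δ` bounds the integral
of `|h|` over every other cube, by averaging over all translates. -/
lemma integral_abs_closedBall_le {h : (Fin n → ℝ) → ℝ} (hh : LocallyIntegrable h) {δ M r : ℝ}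
    (hδ : 0 < δ) (hr : 0 < r) (a : Fin n → ℝ)
    (hM : ∀ y, ∫ x in closedBall y δ, |h x| ≤ M) :
    (2 * δ) ^ n * ∫ x in closedBall a r, |h x| ≤ (2 * (r + δ)) ^ n * M := by
  have hint : ∀ y s, IntegrableOn h (closedBall y s) := fun y s =>
    hh.integrableOn_isCompact (isCompact_closedBall y s)
  have hl : ∀ y s, ENNReal.ofReal (∫ x in closedBall y s, |h x|) =
      ∫⁻ x in closedBall y s, ENNReal.ofReal |h x| := fun y s =>
    ofReal_integral_eq_lintegral_ofReal (hint y s).abs (ae_of_all _ fun x => abs_nonneg (h x))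
  have hM0 : 0 ≤ M := (integral_nonneg fun x => abs_nonneg (h x)).trans (hM 0)
  have hmeas : AEMeasurable (fun x => ENNReal.ofReal |h x|) volume :=
    (hh.aestronglyMeasurable.aemeasurable.abs).ennreal_ofReal
  set F : (Fin n → ℝ) → (Fin n → ℝ) → ENNReal := fun y x =>
    (closedBall y δ).indicator (fun x => ENNReal.ofReal |h x|) x with hF
  have hFmeas : AEMeasurable (Function.uncurry F)
      ((volume.restrict (closedBall a (r + δ))).prod volume) := by
    have hcl : MeasurableSet {p : (Fin n → ℝ) × (Fin n → ℝ) | dist p.2 p.1 ≤ δ} :=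
      (isClosed_le (by fun_prop) continuous_const).measurableSet
    have : Function.uncurry F = {p : (Fin n → ℝ) × (Fin n → ℝ) | dist p.2 p.1 ≤ δ}.indicator
        (fun p => ENNReal.ofReal |h p.2|) := by
      ext ⟨y, x⟩
      simp only [hF, Function.uncurry, Set.indicator, mem_closedBall, Set.mem_ofPred_eq]
    rw [this]
    exact hmeas.comp_snd.indicator hcl
  have hswap := lintegral_lintegral_swap hFmeas
  have hupper : ∫⁻ y in closedBall a (r + δ), ∫⁻ x, F y x ≤
      ENNReal.ofReal ((2 * (r + δ)) ^ n * M) := by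
    calc ∫⁻ y in closedBall a (r + δ), ∫⁻ x, F y x
        ≤ ∫⁻ y in closedBall a (r + δ), ENNReal.ofReal M := by
          refine lintegral_mono fun y => ?_
          simp only [hF]
          rw [lintegral_indicator measurableSet_closedBall, ← hl]
          exact ENNReal.ofReal_le_ofReal (hM y)
      _ = ENNReal.ofReal ((2 * (r + δ)) ^ n * M) := by
          rw [setLIntegral_const, Real.volume_pi_closedBall _ (by positivity), Fintype.card_fin,
            ENNReal.ofReal_mul (by positivity), mul_comm]
  have hlower : ENNReal.ofReal ((2 * δ) ^ n * ∫ x in closedBall a r, |h x|) ≤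
      ∫⁻ x, ∫⁻ y in closedBall a (r + δ), F y x := by
    calc ENNReal.ofReal ((2 * δ) ^ n * ∫ x in closedBall a r, |h x|)
        = ∫⁻ x in closedBall a r, ENNReal.ofReal ((2 * δ) ^ n) * ENNReal.ofReal |h x| := by
          rw [lintegral_const_mul' _ _ ENNReal.ofReal_ne_top, ← hl,
            ENNReal.ofReal_mul (by positivity)]
      _ ≤ ∫⁻ x in closedBall a r, ∫⁻ y in closedBall a (r + δ), F y x := by
          refine setLIntegral_mono' measurableSet_closedBall fun x hx => ?_
          calc ENNReal.ofReal ((2 * δ) ^ n) * ENNReal.ofReal |h x|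
              = ∫⁻ y in closedBall x δ, ENNReal.ofReal |h x| := by
                rw [setLIntegral_const, Real.volume_pi_closedBall _ hδ.le, Fintype.card_fin,
                  mul_comm]
            _ = ∫⁻ y in closedBall x δ, F y x := by
                refine setLIntegral_congr_fun measurableSet_closedBall fun y hy => ?_
                simp only [hF]
                rw [Set.indicator_of_mem (mem_closedBall_comm.1 hy)]
            _ ≤ ∫⁻ y in closedBall a (r + δ), F y x := by
                refine lintegral_mono_set (closedBall_subset_closedBall' ?_)
                rw [mem_closedBall] at hx
                linarith
      _ ≤ ∫⁻ x, ∫⁻ y in closedBall a (r + δ), F y x := setLIntegral_le_lintegral _ _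
  rw [← hswap] at hlower
  exact (ENNReal.ofReal_le_ofReal_iff (by positivity)).1 (hlower.trans hupper)

section Weight

variable {f w : (Fin n → ℝ) → ℝ} {a : Fin n → ℝ} {r : ℝ}

lemma integrable_mul_of_continuous_of_eq_zero (hf : LocallyIntegrable f) (hw : Continuous w)
    (hsupp : ∀ z, z ∉ closedBall a r → w z = 0) : Integrable (fun z => w z * f z) := by
  have hB : IntegrableOn (fun z => w z * f z) (closedBall a r) :=
    (hf.integrableOn_isCompact (isCompact_closedBall a r)).continuousOn_mul hw.continuousOn
      (isCompact_closedBall a r)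
  refine (integrableOn_iff_integrable_of_support_subset fun z hz => ?_).1 hB
  by_contra h
  exact hz (by simp [hsupp z h])

lemma abs_integral_mul_le (hf : LocallyIntegrable f) (hw : Continuous w)
    (hsupp : ∀ z, z ∉ closedBall a r → w z = 0) {K : ℝ} (hK : ∀ z, |w z| ≤ K) :
    |∫ z, w z * f z| ≤ K * ∫ z in closedBall a r, |f z| := by
  have hint := integrable_mul_of_continuous_of_eq_zero hf hw hsupp
  rw [← setIntegral_eq_integral_of_forall_compl_eq_zero (s := closedBall a r)
    (fun z hz => by simp [hsupp z hz]), ← integral_const_mul]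
  refine abs_integral_le_integral_abs.trans ?_
  refine setIntegral_mono_on hint.integrableOn.abs
    ((hf.integrableOn_isCompact (isCompact_closedBall a r)).abs.const_mul K)
    measurableSet_closedBall fun z _ => ?_
  rw [abs_mul]
  exact mul_le_mul_of_nonneg_right (hK z) (abs_nonneg _)

end Weight

/-- The tent of height and radius `δ` around `x`. -/
def tent (δ : ℝ) (x z : Fin n → ℝ) : ℝ := max 0 (δ - dist z x)

/-- The mean of `f` around `x` weighted by the tent of radius `δ`. -/
def tentMean (δ : ℝ) (f : (Fin n → ℝ) → ℝ) (x : Fin n → ℝ) : ℝ :=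
  (∫ z, tent δ (0 : Fin n → ℝ) z)⁻¹ * ∫ z, tent δ x z * f z

section Tent

variable {δ : ℝ} {f : (Fin n → ℝ) → ℝ}

lemma continuous_tent (δ : ℝ) (x : Fin n → ℝ) : Continuous (tent δ x) := by
  unfold tent
  fun_prop

lemma tent_eq_zero {x z : Fin n → ℝ} (h : δ ≤ dist z x) : tent δ x z = 0 :=
  max_eq_left (by linarith)

lemma abs_tent_le (hδ : 0 ≤ δ) (x z : Fin n → ℝ) : |tent δ x z| ≤ δ := by
  rw [tent, abs_of_nonneg (le_max_left _ _)]
  exact max_le hδ (by linarith [dist_nonneg (x := z) (y := x)])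

lemma abs_tent_sub_tent_le (δ : ℝ) (x y z : Fin n → ℝ) :
    |tent δ x z - tent δ y z| ≤ dist x y := by
  unfold tent
  refine (abs_max_sub_max_le_max _ _ _ _).trans (max_le (by simp) ?_)
  rw [sub_sub_sub_cancel_left, dist_comm z y, dist_comm z x, dist_comm x y]
  exact abs_dist_sub_le y x z

lemma tent_eq_zero_of_notMem {a x z : Fin n → ℝ} {r : ℝ} (hx : dist x a + δ ≤ r)
    (hz : z ∉ closedBall a r) : tent δ x z = 0 := by
  rw [mem_closedBall, not_le] at hz
  exact tent_eq_zero (by linarith [dist_triangle z x a])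

lemma integrable_tent (δ : ℝ) (x : Fin n → ℝ) : Integrable (tent δ x) := by
  simpa using integrable_mul_of_continuous_of_eq_zero (f := fun _ => 1)
    (locallyIntegrable_const 1) (continuous_tent δ x)
    (fun z hz => tent_eq_zero_of_notMem (a := x) (r := δ) (by simp) hz)

lemma integral_tent (δ : ℝ) (x : Fin n → ℝ) :
    ∫ z, tent δ x z = ∫ z, tent δ (0 : Fin n → ℝ) z := by
  rw [← integral_sub_right_eq_self (tent δ (0 : Fin n → ℝ)) x]
  simp only [tent, dist_eq_norm, sub_zero]

lemma le_integral_tent (hδ : 0 < δ) : δ / 2 * δ ^ n ≤ ∫ z, tent δ (0 : Fin n → ℝ) z := by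
  have h0 : 0 ≤ᵐ[volume] tent δ (0 : Fin n → ℝ) := ae_of_all _ fun z => le_max_left _ _
  refine le_trans ?_ (setIntegral_le_integral (s := closedBall 0 (δ / 2))
    (integrable_tent δ _) h0)
  have hvol : volume.real (closedBall (0 : Fin n → ℝ) (δ / 2)) = δ ^ n := by
    have := Cube.measureReal_toSet (⟨0, δ / 2, by positivity⟩ : Cube n)
    rw [Cube.toSet] at this
    rw [this]
    ring
  have hc : ∫ _ in closedBall (0 : Fin n → ℝ) (δ / 2), δ / 2 = δ / 2 * δ ^ n := by
    rw [setIntegral_const, hvol, smul_eq_mul, mul_comm]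
  rw [← hc]
  refine setIntegral_mono_on (continuous_const.continuousOn.integrableOn_compact
    (isCompact_closedBall _ _)) (integrable_tent δ _).integrableOn measurableSet_closedBall
    fun z hz => ?_
  rw [mem_closedBall] at hz
  exact le_max_of_le_right (by linarith)

lemma integral_tent_pos (hδ : 0 < δ) : 0 < ∫ z, tent δ (0 : Fin n → ℝ) z :=
  lt_of_lt_of_le (by positivity) (le_integral_tent hδ)

/-- On the middle half of a cube `P` of half-side `2δ`, the tent means of `f` are as close to a
constant `c` as `f` is on average over `P`. -/
lemma abs_tentMean_sub_le (hf : LocallyIntegrable f) (hδ : 0 < δ) (P : Cube n)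
    (hP : P.half = 2 * δ) (c : ℝ) {x : Fin n → ℝ} (hx : x ∈ closedBall P.center δ) :
    |tentMean δ f x - c| ≤ 2 * 4 ^ n * P.avgAbs (fun z => f z - c) := by
  have hW := integral_tent_pos (n := n) hδ
  have hW' := le_integral_tent (n := n) hδ
  rw [mem_closedBall] at hx
  have hsupp : ∀ z, z ∉ closedBall P.center P.half → tent δ x z = 0 := fun z hz =>
    tent_eq_zero_of_notMem (by linarith) hz
  have h1 := integrable_mul_of_continuous_of_eq_zero hf (continuous_tent δ x) hsupp
  have hfc : LocallyIntegrable (fun z => f z - c) := hf.sub (locallyIntegrable_const c)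
  have heq : tentMean δ f x - c =
      (∫ z, tent δ (0 : Fin n → ℝ) z)⁻¹ * ∫ z, tent δ x z * (f z - c) := by
    simp only [mul_sub]
    rw [integral_sub h1 ((integrable_tent δ x).mul_const c), integral_mul_const, integral_tent δ x,
      tentMean]
    field_simp
  have hb := abs_integral_mul_le hfc (continuous_tent δ x) hsupp (abs_tent_le hδ.le x)
  have hI : ∫ z in closedBall P.center P.half, |f z - c| =
      (4 * δ) ^ n * P.avgAbs (fun z => f z - c) := by
    have := P.integral_abs_eq (fun z => f z - c)
    rw [P.measureReal_toSet, hP] at this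
    rw [← Cube.toSet, this]
    ring
  rw [hI] at hb
  rw [heq, abs_mul, abs_of_pos (inv_pos.2 hW), inv_mul_le_iff₀ hW]
  have h2 := P.avgAbs_nonneg (fun z => f z - c)
  calc _ ≤ _ := hb
    _ = (δ / 2 * δ ^ n) * (2 * 4 ^ n * P.avgAbs (fun z => f z - c)) := by rw [mul_pow]; ring
    _ ≤ _ := mul_le_mul_of_nonneg_right hW' (by positivity)

lemma uniformContinuous_tentMean (hf : LocallyIntegrable f) (hδ : 0 < δ) {M : ℝ}
    (hM : ∀ y, ∫ z in closedBall y (2 * δ), |f z| ≤ M) : UniformContinuous (tentMean δ f) := by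
  have hW := integral_tent_pos (n := n) hδ
  have hM0 : 0 ≤ M := (integral_nonneg fun x => abs_nonneg (f x)).trans (hM 0)
  have hlip : ∀ x y, dist x y ≤ δ → dist (tentMean δ f x) (tentMean δ f y) ≤
      (∫ z, tent δ (0 : Fin n → ℝ) z)⁻¹ * (M * dist x y) := by
    intro x y hxy
    have hx : ∀ z, z ∉ closedBall x (2 * δ) → tent δ x z = 0 := fun z hz =>
      tent_eq_zero_of_notMem (by rw [dist_self]; linarith) hz
    have hy : ∀ z, z ∉ closedBall x (2 * δ) → tent δ y z = 0 := fun z hz =>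
      tent_eq_zero_of_notMem (by rw [dist_comm]; linarith) hz
    have hb := abs_integral_mul_le hf ((continuous_tent δ x).sub (continuous_tent δ y))
      (a := x) (r := 2 * δ) (fun z hz => by simp [hx z hz, hy z hz]) (abs_tent_sub_tent_le δ x y)
    simp only [Pi.sub_apply, sub_mul] at hb
    rw [integral_sub (integrable_mul_of_continuous_of_eq_zero hf (continuous_tent δ x) hx)
      (integrable_mul_of_continuous_of_eq_zero hf (continuous_tent δ y) hy)] at hb
    rw [Real.dist_eq, tentMean, tentMean, ← mul_sub, abs_mul, abs_of_pos (inv_pos.2 hW)]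
    refine mul_le_mul_of_nonneg_left (hb.trans ?_) (inv_pos.2 hW).le
    rw [mul_comm M]
    exact mul_le_mul_of_nonneg_left (hM x) dist_nonneg
  rw [Metric.uniformContinuous_iff]
  intro ε hε
  set W := ∫ z, tent δ (0 : Fin n → ℝ) z
  refine ⟨min δ (ε * W / (M + 1)), by positivity, fun x y hxy => ?_⟩
  refine (hlip x y (hxy.le.trans (min_le_left _ _))).trans_lt ?_
  have h1 := hxy.trans_le (min_le_right _ _)
  rw [lt_div_iff₀ (by positivity)] at h1
  rw [inv_mul_lt_iff₀ hW]
  nlinarith [dist_nonneg (x := x) (y := y)]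

end Tent

section Approximation

variable {δ η : ℝ} {f : (Fin n → ℝ) → ℝ}

lemma osc_sub_tentMean_le (hf : LocallyIntegrable f) (hg : Continuous (tentMean δ f))
    (hδ : 0 < δ) (hosc : ∀ Q : Cube n, Q.half ≤ 2 * δ → Q.osc f ≤ η) (Q : Cube n)
    (hQ : Q.half ≤ δ) : Q.osc (f - tentMean δ f) ≤ (1 + 4 * 4 ^ n) * η := by
  let P : Cube n := ⟨Q.center, 2 * δ, by positivity⟩
  have hPη := hosc P le_rfl
  have hP0 := P.osc_nonneg f
  have hgQ := hg.continuousOn.integrableOn_compact Q.isCompact_toSet (μ := volume)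
  have h1 := Q.osc_sub_le (hf.integrableOn_isCompact Q.isCompact_toSet) hgQ
  have h2 : Q.osc (tentMean δ f) ≤ 2 * (2 * 4 ^ n * P.osc f) :=
    Q.osc_le_of_forall_abs_sub_le hgQ (by positivity) fun x hx =>
      abs_tentMean_sub_le hf hδ P rfl (P.avg f) (closedBall_subset_closedBall hQ hx)
  have h3 : 2 * (2 * 4 ^ n * P.osc f) ≤ 2 * (2 * 4 ^ n * η) := by gcongr
  have h4 := hosc Q (by linarith)
  linarith

lemma avgAbs_sub_tentMean_le_of_half_eq (hf : LocallyIntegrable f)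
    (hg : Continuous (tentMean δ f)) (hδ : 0 < δ)
    (hosc : ∀ Q : Cube n, Q.half ≤ 2 * δ → Q.osc f ≤ η) (Q : Cube n)
    (hQ : Q.half = δ) : Q.avgAbs (f - tentMean δ f) ≤ (2 ^ n + 2 * 4 ^ n) * η := by
  let P : Cube n := ⟨Q.center, 2 * δ, by positivity⟩
  have hPη := hosc P le_rfl
  have hP0 := P.osc_nonneg f
  have hgQ := hg.continuousOn.integrableOn_compact Q.isCompact_toSet (μ := volume)
  have hfQ := hf.integrableOn_isCompact Q.isCompact_toSet
  have hfP := hf.integrableOn_isCompact P.isCompact_toSet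
  have hc := Q.integrableOn_const (P.avg f)
  have h1 : Q.avgAbs (f - tentMean δ f) ≤
      Q.avgAbs (fun x => f x - P.avg f) + Q.avgAbs (fun x => tentMean δ f x - P.avg f) := by
    refine Q.avgAbs_le_of_le_add (hfQ.sub hgQ) (hfQ.sub hc) (hgQ.sub hc) fun x _ => ?_
    have := abs_sub (f x - P.avg f) (tentMean δ f x - P.avg f)
    rwa [sub_sub_sub_cancel_right] at this
  have h2 : Q.avgAbs (fun x => tentMean δ f x - P.avg f) ≤ 2 * 4 ^ n * P.osc f :=
    Q.avgAbs_le_of_forall_le (hgQ.sub hc) (by positivity) fun x hx =>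
      abs_tentMean_sub_le hf hδ P rfl (P.avg f) (closedBall_subset_closedBall hQ.le hx)
  have h3 : Q.avgAbs (fun x => f x - P.avg f) ≤ 2 ^ n * P.osc f := by
    rw [Cube.avgAbs_eq, inv_mul_le_iff₀ Q.measureReal_toSet_pos, Q.measureReal_toSet, hQ]
    have hsub : Q.toSet ⊆ P.toSet := closedBall_subset_closedBall (by
      change Q.half ≤ 2 * δ
      linarith)
    have hI : ∫ x in P.toSet, |f x - P.avg f| = (2 * (2 * δ)) ^ n * P.osc f := by
      rw [P.integral_abs_eq, P.measureReal_toSet, Cube.osc_eq_avgAbs]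
    calc ∫ x in Q.toSet, |f x - P.avg f|
        ≤ ∫ x in P.toSet, |f x - P.avg f| :=
          setIntegral_mono_set (hfP.sub (P.integrableOn_const (P.avg f))).abs
            (ae_of_all _ fun x => abs_nonneg _) hsub.eventuallyLE
      _ = (2 * δ) ^ n * (2 ^ n * P.osc f) := by rw [hI, mul_pow 2 (2 * δ)]; ring
  have h4 : (2 ^ n + 2 * 4 ^ n) * P.osc f ≤ (2 ^ n + 2 * 4 ^ n) * η := by gcongr
  linarith

lemma avgAbs_sub_tentMean_le (hf : LocallyIntegrable f) (hg : Continuous (tentMean δ f))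
    (hδ : 0 < δ) (hosc : ∀ Q : Cube n, Q.half ≤ 2 * δ → Q.osc f ≤ η) (Q : Cube n)
    (hQ : δ ≤ Q.half) :
    Q.avgAbs (f - tentMean δ f) ≤ 2 ^ n * ((2 ^ n + 2 * 4 ^ n) * η) := by
  set A := (2 ^ n + 2 * 4 ^ n) * η
  have hpos := Q.half_pos
  have hA : 0 ≤ A := (Cube.avgAbs_nonneg _ _).trans
    (avgAbs_sub_tentMean_le_of_half_eq hf hg hδ hosc ⟨0, δ, hδ⟩ rfl)
  have hM : ∀ y, ∫ x in closedBall y δ, |(f - tentMean δ f) x| ≤ (2 * δ) ^ n * A := by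
    intro y
    let P : Cube n := ⟨y, δ, hδ⟩
    have h1 := P.integral_abs_eq (f - tentMean δ f)
    rw [P.measureReal_toSet] at h1
    refine h1.le.trans (mul_le_mul_of_nonneg_left ?_ (by positivity))
    exact avgAbs_sub_tentMean_le_of_half_eq hf hg hδ hosc P rfl
  have h2 := integral_abs_closedBall_le (hf.sub hg.locallyIntegrable) hδ hpos Q.center hM
  rw [mul_left_comm, mul_le_mul_iff_right₀ (by positivity)] at h2
  rw [Cube.avgAbs_eq, inv_mul_le_iff₀ Q.measureReal_toSet_pos, Q.measureReal_toSet]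
  refine h2.trans ?_
  calc (2 * (Q.half + δ)) ^ n * A ≤ (2 * (2 * Q.half)) ^ n * A := by
        gcongr
        linarith
    _ = (2 * Q.half) ^ n * (2 ^ n * A) := by rw [mul_pow 2 (2 * Q.half)]; ring

end Approximation

section Bmo

variable {f g : (Fin n → ℝ) → ℝ}

lemma MemBmo.locallyIntegrable {lam : ℝ} (hf : MemBmo Set.univ lam f) : LocallyIntegrable f :=
  fun x => ⟨closedBall x 1, closedBall_mem_nhds x one_pos,
    hf.1 ⟨x, 1, one_pos⟩ (Set.subset_univ _)⟩

lemma omegaOn_nonneg (U : Set (Fin n → ℝ)) (f : (Fin n → ℝ) → ℝ) (t : ℝ) :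
    0 ≤ omegaOn U f t :=
  Real.sSup_nonneg fun _ ⟨Q, _, _, hr⟩ => hr ▸ Q.osc_nonneg f

lemma bigAvgSup_nonneg (U : Set (Fin n → ℝ)) (lam : ℝ) (f : (Fin n → ℝ) → ℝ) :
    0 ≤ bigAvgSup U lam f :=
  Real.sSup_nonneg fun _ ⟨Q, _, _, hr⟩ => hr ▸ Q.avgAbs_nonneg f

lemma osc_le_omegaOn {U : Set (Fin n → ℝ)} {t : ℝ}
    (hbdd : BddAbove {r | ∃ Q : Cube n, Q.toSet ⊆ U ∧ Q.side < t ∧ r = Q.osc f})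
    {Q : Cube n} (hQU : Q.toSet ⊆ U) (hQ : Q.side < t) : Q.osc f ≤ omegaOn U f t :=
  le_csSup hbdd ⟨Q, hQU, hQ, rfl⟩

/-- Functions with vanishing mean oscillation are `bmo`-approximable by their tent means. -/
lemma exists_bmoNorm_sub_le (hf : MemBmo Set.univ 1 f) (hv : VanishSmallOsc Set.univ f)
    {ε : ℝ} (hε : 0 < ε) : ∃ g : (Fin n → ℝ) → ℝ,
      (BoundedOn Set.univ g ∧ UniformContinuous g) ∧ bmoNorm Set.univ 1 (f - g) ≤ ε := by
  have hloc := hf.locallyIntegrable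
  set A : ℝ := 2 ^ n * (2 ^ n + 2 * 4 ^ n) with hA
  have hA0 : 0 < A := by positivity
  set η := ε / (1 + 4 * 4 ^ n + 3 * A) with hη
  have hη0 : 0 < η := by positivity
  have hev : ∀ᶠ t in 𝓝[>] (0 : ℝ), t < 1 ∧ 0 < t ∧ omegaOn Set.univ f t < η := by
    filter_upwards [hv.eventually_lt_const hη0, self_mem_nhdsWithin,
      nhdsWithin_le_nhds (eventually_lt_nhds (zero_lt_one (α := ℝ)))] with t h1 h2 h3
    exact ⟨h3, h2, h1⟩
  obtain ⟨t, ht1, ht0, htη⟩ := hev.exists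
  set δ := t / 8 with hδ'
  have hδ : 0 < δ := by positivity
  have hosc : ∀ Q : Cube n, Q.half ≤ 2 * δ → Q.osc f ≤ η := by
    intro Q hQ
    have hside : Q.side < t := by
      rw [Cube.side]
      linarith
    refine (osc_le_omegaOn ?_ (Set.subset_univ _) hside).trans htη.le
    refine hf.2.1.mono ?_
    rintro _ ⟨P, h1, h2, h3⟩
    exact ⟨P, h1, h2.trans ht1, h3⟩
  obtain ⟨M, hM⟩ := hf.2.2
  have hMint : ∀ y, ∫ z in closedBall y (2 * δ), |f z| ≤ M := by
    intro y
    let Q : Cube n := ⟨y, 1 / 2, by norm_num⟩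
    have h1 : Q.avgAbs f ≤ M := hM ⟨Q, Set.subset_univ _, by norm_num [Cube.side, Q], rfl⟩
    have h2 := Q.integral_abs_eq f
    rw [Q.measureReal_toSet] at h2
    have h3 : (2 * Q.half) ^ n = 1 := by norm_num [Q]
    rw [h3, one_mul] at h2
    rw [← h2] at h1
    have hsub : closedBall y (2 * δ) ⊆ Q.toSet := closedBall_subset_closedBall (by
      change 2 * δ ≤ 1 / 2
      linarith)
    exact (setIntegral_mono_set (hloc.integrableOn_isCompact Q.isCompact_toSet).abs
      (ae_of_all _ fun x => abs_nonneg _) hsub.eventuallyLE).trans h1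
  have huc := uniformContinuous_tentMean hloc hδ hMint
  have hc := huc.continuous
  have hbdd : BoundedOn Set.univ (tentMean δ f) := by
    refine ⟨2 * 4 ^ n * (((2 * (2 * δ)) ^ n)⁻¹ * M), fun x _ => ?_⟩
    let P : Cube n := ⟨x, 2 * δ, by positivity⟩
    have h1 := abs_tentMean_sub_le hloc hδ P rfl 0 (mem_closedBall_self hδ.le)
    simp only [sub_zero] at h1
    refine h1.trans (mul_le_mul_of_nonneg_left ?_ (by positivity))
    rw [P.avgAbs_eq, P.measureReal_toSet]
    exact mul_le_mul_of_nonneg_left (hMint x) (by positivity)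
  refine ⟨tentMean δ f, ⟨hbdd, huc⟩, ?_⟩
  have hbig : bigAvgSup Set.univ 1 (f - tentMean δ f) ≤ A * η := by
    refine Real.sSup_le ?_ (by positivity)
    rintro _ ⟨Q, _, hQ, rfl⟩
    rw [Cube.side] at hQ
    rw [hA, mul_assoc]
    exact avgAbs_sub_tentMean_le hloc hc hδ hosc Q (by linarith)
  have hsmall : omegaOn Set.univ (f - tentMean δ f) 1 ≤ (1 + 4 * 4 ^ n) * η + 2 * (A * η) := by
    refine Real.sSup_le ?_ (by positivity)
    rintro _ ⟨Q, _, _, rfl⟩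
    rcases le_total Q.half δ with hQ | hQ
    · exact (osc_sub_tentMean_le hloc hc hδ hosc Q hQ).trans
        (le_add_of_nonneg_right (by positivity))
    · refine le_trans ?_ (le_add_of_nonneg_left (by positivity))
      refine (Q.osc_le_two_mul_avgAbs
        ((hloc.sub hc.locallyIntegrable).integrableOn_isCompact Q.isCompact_toSet)).trans ?_
      rw [hA, mul_assoc (2 ^ n)]
      exact mul_le_mul_of_nonneg_left (avgAbs_sub_tentMean_le hloc hc hδ hosc Q hQ) two_pos.le
  have hsum : (1 + 4 * 4 ^ n + 3 * A) * η = ε := by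
    rw [hη]
    field_simp
  rw [bmoNorm]
  linarith

/-- After subtracting a bounded continuous function from `f ∈ bmo`, the mean oscillations over
small cubes are still controlled by the norm. -/
lemma MemBmo.osc_sub_le_bmoNorm (hf : MemBmo Set.univ 1 f) (hb : BoundedOn Set.univ g)
    (hg : Continuous g) (Q : Cube n) (hQ : Q.side < 1) :
    Q.osc (f - g) ≤ bmoNorm Set.univ 1 (f - g) := by
  obtain ⟨B, hB⟩ := hf.2.1
  obtain ⟨M, hM⟩ := hb
  have hM0 : 0 ≤ M := (abs_nonneg _).trans (hM 0 trivial)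
  refine le_trans (osc_le_omegaOn ⟨B + 2 * M, ?_⟩ (Set.subset_univ _) hQ)
    (le_add_of_nonneg_right (bigAvgSup_nonneg _ _ _))
  rintro _ ⟨P, hPU, hP, rfl⟩
  have hgP := hg.continuousOn.integrableOn_compact P.isCompact_toSet (μ := volume)
  refine (P.osc_sub_le (hf.1 P hPU) hgP).trans (add_le_add (hB ⟨P, hPU, hP, rfl⟩) ?_)
  exact P.osc_le_of_forall_abs_sub_le (c := 0) hgP hM0 fun x _ => by simpa using hM x trivial

lemma VanishSmallOsc.of_tendsto_bmoNorm (hf : MemBmo Set.univ 1 f)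
    {g : ℕ → (Fin n → ℝ) → ℝ} (hg : ∀ j, BoundedOn Set.univ (g j) ∧ UniformContinuous (g j))
    (hlim : Tendsto (fun j => bmoNorm Set.univ 1 (f - g j)) atTop (𝓝 0)) :
    VanishSmallOsc Set.univ f := by
  refine Metric.tendsto_nhds.2 fun ε hε => ?_
  obtain ⟨j, hj⟩ := (hlim.eventually_lt_const (show 0 < ε / 4 by positivity)).exists
  obtain ⟨hb, huc⟩ := hg j
  obtain ⟨s, hs, hgs⟩ := Metric.uniformContinuous_iff.1 huc (ε / 8) (by positivity)
  filter_upwards [nhdsWithin_le_nhds (eventually_lt_nhds hs),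
    nhdsWithin_le_nhds (eventually_lt_nhds (zero_lt_one (α := ℝ)))] with t hts ht1
  rw [Real.dist_0_eq_abs, abs_of_nonneg (omegaOn_nonneg _ _ _)]
  refine lt_of_le_of_lt (Real.sSup_le (a := ε / 2) ?_ (by positivity)) (by linarith)
  rintro _ ⟨Q, hQU, hQ, rfl⟩
  have hc := huc.continuous
  have hgQ := hc.continuousOn.integrableOn_compact Q.isCompact_toSet (μ := volume)
  have h1 := hf.osc_sub_le_bmoNorm hb hc Q (hQ.trans ht1)
  have h2 : Q.osc (-g j) ≤ 2 * (ε / 8) := by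
    refine Q.osc_le_of_forall_abs_sub_le (c := -g j Q.center) hgQ.neg (by positivity)
      fun x hx => ?_
    have hx' : dist Q.center x < s := by
      rw [dist_comm]
      rw [Cube.side] at hQ
      have := mem_closedBall.1 hx
      linarith [Q.half_pos]
    have := (hgs hx').le
    rwa [Real.dist_eq, ← neg_sub_neg, abs_sub_comm, abs_sub_comm] at this
  have h3 := Q.osc_sub_le ((hf.1 Q hQU).sub hgQ) hgQ.neg
  rw [sub_neg_eq_add, sub_add_cancel] at h3
  linarith

end Bmo

/-- Bourdaud's theorem: f ∈ bmo(ℝⁿ) has vanishing mean oscillation iff it is a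
bmo-limit of bounded uniformly continuous functions. -/
theorem stmt4 {n : ℕ} (hn : 0 < n) (f : (Fin n → ℝ) → ℝ)
    (hf : MemBmo (Set.univ : Set (Fin n → ℝ)) 1 f) :
    VanishSmallOsc (Set.univ : Set (Fin n → ℝ)) f ↔
      ∃ g : ℕ → (Fin n → ℝ) → ℝ,
        (∀ j, BoundedOn Set.univ (g j) ∧ UniformContinuous (g j)) ∧
        Tendsto (fun j => bmoNorm Set.univ 1 (f - g j)) atTop (nhds 0) := by
  refine ⟨fun hv => ?_, fun ⟨g, hg, hlim⟩ => VanishSmallOsc.of_tendsto_bmoNorm hf hg hlim⟩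
  choose g hg hle using fun j : ℕ =>
    exists_bmoNorm_sub_le hf hv (Nat.one_div_pos_of_nat (α := ℝ) (n := j))
  refine ⟨g, hg, squeeze_zero (fun j => ?_) hle tendsto_one_div_add_atTop_nhds_zero_nat⟩
  exact add_nonneg (omegaOn_nonneg _ _ _) (bigAvgSup_nonneg _ _ _)
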